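/- Let h : [0,T]×ℝ → ℝ be a Carathéodory function satisfying condition (A₁ᴵ) (there exists γ ∈ L¹([0,T],[0,+∞)) with h(t,u) ≥ −γ(t) for a.e. t and all u ∈ ℝ) and the Villari condition at −∞ with δ = 1 (there exists d₀ > 0 such that ∫₀ᵀ h(t,u(t)) dt > 0 for every u ∈ C¹_T with u(t) ≤ −d₀ for all t ∈ [0,T]). Suppose there exists β ∈ 𝔇 which is a strict upper solution of the equation (φ(u'))' + f(u)u' + h(t,u) = 0. Then this equation has at least one T-periodic solution ũ with ũ(t) < β(t) for all t ∈ [0,T]. -/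

import Mathlib

open MeasureTheory Set Filter

noncomputable section

/-- The Lebesgue measure restricted to the interval `[0,T]`. -/
def muT (T : ℝ) : Measure ℝ := volume.restrict (Icc 0 T)

/-- `u` is a `C¹` function on `[0,T]` with derivative `u'` there, satisfying the
`T`-periodic boundary conditions `u 0 = u T` and `u' 0 = u' T`. -/
def IsC1Periodic (T : ℝ) (u u' : ℝ → ℝ) : Prop :=
  (∀ t ∈ Icc (0:ℝ) T, HasDerivWithinAt u (u' t) (Icc (0:ℝ) T) t) ∧
    ContinuousOn u' (Icc (0:ℝ) T) ∧ u 0 = u T ∧ u' 0 = u' T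

/-- `φ ∘ u'` is absolutely continuous on `[0,T]`, being the indefinite integral of the
integrable function `w` (which is then its a.e. derivative). -/
def IsACPhiDeriv (T : ℝ) (φ : ℝ → ℝ) (u' w : ℝ → ℝ) : Prop :=
  IntegrableOn w (Icc (0:ℝ) T) ∧
    ∀ t ∈ Icc (0:ℝ) T, φ (u' t) = φ (u' 0) + ∫ τ in (0:ℝ)..t, w τ

/-- `h : [0,T] × ℝ → ℝ` is a Carathéodory function: measurable in `t`, continuous in `u`
for a.e. `t`, and locally `L¹`-dominated. -/
def Caratheodory (T : ℝ) (h : ℝ → ℝ → ℝ) : Prop :=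
  (∀ u : ℝ, Measurable fun t => h t u) ∧
    (∀ᵐ t ∂(muT T), Continuous fun u => h t u) ∧
    ∀ r : ℝ, 0 < r → ∃ γ : ℝ → ℝ, IntegrableOn γ (Icc (0:ℝ) T) ∧
      ∀ᵐ t ∂(muT T), ∀ u : ℝ, |u| ≤ r → |h t u| ≤ γ t

/-- `u` is a `T`-periodic solution of `(φ(u'))' + f(u)u' + h(t,u) = 0`. -/
def IsSolE (T : ℝ) (φ f : ℝ → ℝ) (h : ℝ → ℝ → ℝ) (u : ℝ → ℝ) : Prop :=
  ∃ u' w : ℝ → ℝ, IsC1Periodic T u u' ∧ IsACPhiDeriv T φ u' w ∧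
    ∀ᵐ t ∂(muT T), w t + f (u t) * u' t + h t (u t) = 0

/-- Condition `(A₀)`: local uniform control of `h(t,u) − h(t,u₀)` for a.e. `t`. -/
def CondA0 (T : ℝ) (h : ℝ → ℝ → ℝ) : Prop :=
  ∀ t₀ ∈ Icc (0:ℝ) T, ∀ u₀ : ℝ, ∀ ε : ℝ, 0 < ε → ∃ δ : ℝ, 0 < δ ∧
    ∀ᵐ t ∂(muT T), |t - t₀| < δ → ∀ u : ℝ, |u - u₀| < δ → |h t u - h t u₀| < ε

open scoped Topology

theorem exists_zero_of_quasimonotone {ι : Type*} [DecidableEq ι] (P : ι → (ι → ℝ) → ℝ)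
    {a b : ℝ} (hab : a ≤ b)
    (hmono : ∀ i u v, u ≤ v → u i = v i → P i u ≤ P i v)
    (hcont : ∀ i u, Continuous fun s => P i (Function.update u i s))
    (ha : ∀ i, 0 ≤ P i fun _ => a) (hb : ∀ i, P i (fun _ => b) ≤ 0) :
    ∃ u : ι → ℝ, (∀ i, u i ∈ Icc a b) ∧ ∀ i, P i u = 0 := by
  set S : Set (ι → ℝ) := {u | (∀ i, u i ∈ Icc a b) ∧ ∀ i, 0 ≤ P i u} with hS
  have haS : (fun _ => a) ∈ S := ⟨fun _ => ⟨le_rfl, hab⟩, ha⟩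
  have hbdd : ∀ i, BddAbove ((fun u : ι → ℝ => u i) '' S) := by
    rintro i
    refine ⟨b, ?_⟩
    rintro _ ⟨u, hu, rfl⟩
    exact (hu.1 i).2
  set m : ι → ℝ := fun i => sSup ((fun u : ι → ℝ => u i) '' S) with hm
  have hle : ∀ u ∈ S, u ≤ m := fun u hu i => le_csSup (hbdd i) ⟨u, hu, rfl⟩
  have hmab : ∀ i, m i ∈ Icc a b := by
    intro i
    refine ⟨hle _ haS i, csSup_le ⟨a, _, haS, rfl⟩ ?_⟩
    rintro _ ⟨u, hu, rfl⟩
    exact (hu.1 i).2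
  have hmS : m ∈ S := by
    refine ⟨hmab, fun i => ?_⟩
    by_contra! hneg
    have hopen : IsOpen {s | P i (Function.update m i s) < 0} :=
      isOpen_lt (hcont i m) continuous_const
    have hmem : m i ∈ {s | P i (Function.update m i s) < 0} := by
      simpa using hneg
    obtain ⟨ε, hε, hball⟩ := Metric.isOpen_iff.1 hopen _ hmem
    obtain ⟨_, ⟨u, hu, rfl⟩, hlt⟩ :=
      exists_lt_of_lt_csSup (s := (fun u : ι → ℝ => u i) '' S) ⟨a, _, haS, rfl⟩
        (show m i - ε < sSup ((fun u : ι → ℝ => u i) '' S) from sub_lt_self _ hε)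
    have h1 : P i (Function.update m i (u i)) < 0 := by
      apply hball
      rw [Metric.mem_ball, Real.dist_eq, abs_lt]
      have := hle u hu i
      constructor <;> linarith
    have h2 : P i u ≤ P i (Function.update m i (u i)) := by
      apply hmono
      · intro j
        rcases eq_or_ne j i with rfl | hj
        · simp
        · simpa [hj] using hle u hu j
      · simp
    linarith [hu.2 i]
  refine ⟨m, hmab, fun i => le_antisymm ?_ (hmS.2 i)⟩
  by_contra! hpos
  have hlt : m i < b := by
    refine lt_of_le_of_ne (hmab i).2 fun h => ?_
    have := hmono i m (fun _ => b) (fun j => (hmab j).2) h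
    linarith [hb i]
  have hopen : IsOpen {s | 0 < P i (Function.update m i s)} :=
    isOpen_lt continuous_const (hcont i m)
  have hmem : m i ∈ {s | 0 < P i (Function.update m i s)} := by
    simpa using hpos
  obtain ⟨ε, hε, hball⟩ := Metric.isOpen_iff.1 hopen _ hmem
  set s := min b (m i + ε / 2) with hs
  have hs1 : m i < s := lt_min hlt (by linarith)
  have hs2 : 0 < P i (Function.update m i s) := by
    apply hball
    rw [Metric.mem_ball, Real.dist_eq, abs_lt]
    have : s ≤ m i + ε / 2 := min_le_right _ _
    constructor <;> linarith
  have hup : m ≤ Function.update m i s := by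
    intro j
    rcases eq_or_ne j i with rfl | hj
    · simpa using hs1.le
    · simp [hj]
  have hnew : Function.update m i s ∈ S := by
    constructor
    · intro j
      rcases eq_or_ne j i with rfl | hj
      · simpa using ⟨(hmab j).1.trans hs1.le, min_le_left _ _⟩
      · simpa [hj] using hmab j
    · intro j
      rcases eq_or_ne j i with rfl | hj
      · exact hs2.le
      · exact (hmS.2 j).trans (hmono j _ _ hup (by simp [hj]))
  have := hle _ hnew i
  simp at this
  linarith

theorem exists_periodic_difference_solution (N : ℕ) [NeZero N] {φ Fp Fm : ℝ → ℝ}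
    (hφ : Monotone φ) (hφc : Continuous φ) (hFp : Monotone Fp) (hFpc : Continuous Fp)
    (hFm : Monotone Fm) (hFmc : Continuous Fm) {δ : ℝ} (hδ : 0 < δ) {a b : ℝ} (hab : a ≤ b)
    {H : ℕ → ℝ → ℝ} (hH : ∀ k, Continuous (H k)) (hHa : ∀ k, 0 ≤ H k a) (hHb : ∀ k, H k b ≤ 0) :
    ∃ (U : ℕ → ℝ) (c : ℝ), (∀ k, U k ∈ Icc a b) ∧ U N = U 0 ∧
      (∀ k < N, φ ((U (k + 1) - U k) / δ) + Fp (U (k + 1)) - Fm (U k) +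
        ∑ j ∈ Finset.range (k + 1), H j (U j) = c) ∧
      ∑ j ∈ Finset.range N, H j (U j) = 0 := by
  set q : (ZMod N → ℝ) → ZMod N → ℝ :=
    fun u i => φ ((u (i + 1) - u i) / δ) + Fp (u (i + 1)) - Fm (u i) with hq
  have key : ∃ u : ZMod N → ℝ, (∀ i, u i ∈ Icc a b) ∧
      ∀ i, q u i - q u (i - 1) + H i.val (u i) = 0 := by
    refine exists_zero_of_quasimonotone
      (fun (i : ZMod N) u => q u i - q u (i - 1) + H i.val (u i)) hab ?_ ?_ ?_ ?_
    · intro i u v huv hi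
      simp only [hq, sub_add_cancel, hi]
      have h1 := hφ (div_le_div_of_nonneg_right (sub_le_sub_right (huv (i + 1)) (v i)) hδ.le)
      have h2 := hφ (div_le_div_of_nonneg_right (sub_le_sub_left (huv (i - 1)) (v i)) hδ.le)
      have h3 := hFp (huv (i + 1))
      have h4 := hFm (huv (i - 1))
      linarith
    · intro i u
      have hupd : Continuous (Function.update u i) := continuous_const.update i continuous_id
      have hu : ∀ j, Continuous fun s => Function.update u i s j := fun j =>
        (continuous_apply j).comp hupd
      have hHc := hH i.val
      simp only [hq]
      fun_prop
    · intro i; simpa [hq] using hHa _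
    · intro i; simpa [hq] using hHb _
  obtain ⟨u, hu, heq⟩ := key
  have hsum : ∀ k < N, q u (k : ZMod N) + ∑ j ∈ Finset.range (k + 1), H j (u j) = q u (-1) := by
    intro k
    induction k with
    | zero =>
      intro hk
      have := heq 0
      simp at this ⊢
      linarith
    | succ k ih =>
      intro hk
      have h1 := ih (by omega)
      have h2 := heq ((k + 1 : ℕ) : ZMod N)
      rw [Finset.sum_range_succ]
      rw [ZMod.val_natCast_of_lt hk] at h2
      have h3 : ((k + 1 : ℕ) : ZMod N) - 1 = k := by push_cast; ring
      rw [h3] at h2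
      linarith
  refine ⟨fun k => u k, q u (-1), fun k => hu _, by simp, fun k hk => ?_, ?_⟩
  · have := hsum k hk
    simpa [hq] using this
  · have hN : 0 < N := Nat.pos_of_ne_zero (NeZero.ne N)
    have := hsum (N - 1) (by omega)
    rw [Nat.sub_add_cancel hN] at this
    have h3 : ((N - 1 : ℕ) : ZMod N) = -1 := by
      rw [Nat.cast_sub hN]; simp
    rw [h3] at this
    simpa using this

theorem integral_floor_step {δ : ℝ} (hδ : 0 < δ) (G : ℕ → ℝ → ℝ)
    (hG : ∀ p q, IntervalIntegrable (fun t => G ⌊t / δ⌋₊ t) volume p q) (k : ℕ) :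
    ∫ t in (0 : ℝ)..k * δ, G ⌊t / δ⌋₊ t =
      ∑ j ∈ Finset.range k, ∫ t in (j * δ)..((j + 1 : ℕ) * δ), G j t := by
  have h := intervalIntegral.sum_integral_adjacent_intervals (μ := volume)
    (f := fun t => G ⌊t / δ⌋₊ t) (a := fun j : ℕ => (j : ℝ) * δ) (n := k) (fun _ _ => hG _ _)
  simp only [Nat.cast_zero, zero_mul] at h
  rw [← h]
  refine Finset.sum_congr rfl fun j _ => ?_
  have hle : (j : ℝ) * δ ≤ (j + 1 : ℕ) * δ := by
    push_cast; nlinarith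
  refine intervalIntegral.integral_congr_ae ?_
  have hne : ∀ᵐ t : ℝ ∂volume, t ≠ (j + 1 : ℕ) * δ := by
    simp [ae_iff, measure_singleton]
  filter_upwards [hne] with t ht hmem
  rw [uIoc_of_le hle] at hmem
  have : ⌊t / δ⌋₊ = j := by
    rw [Nat.floor_eq_iff (div_nonneg ((by positivity : (0 : ℝ) ≤ j * δ).trans hmem.1.le) hδ.le)]
    constructor
    · rw [le_div_iff₀ hδ]; exact hmem.1.le
    · rw [div_lt_iff₀ hδ]; exact_mod_cast lt_of_le_of_ne hmem.2 ht
  rw [this]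

theorem abs_integral_le_mul_of_bound {d : ℝ → ℝ} {D p q : ℝ} (hpq : p ≤ q)
    (h : ∀ t ∈ Ioo p q, |d t| ≤ D) : |∫ t in p..q, d t| ≤ D * (q - p) := by
  have hne : ∀ᵐ t : ℝ ∂volume, t ≠ q := by
    simp [ae_iff, measure_singleton]
  have := intervalIntegral.norm_integral_le_of_norm_le_const_ae (f := d) (a := p) (b := q) (C := D)
    (by
      filter_upwards [hne] with t ht hmem
      rw [uIoc_of_le hpq] at hmem
      exact h t ⟨hmem.1, lt_of_le_of_ne hmem.2 ht⟩)
  rwa [abs_of_nonneg (sub_nonneg.2 hpq)] at this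

theorem exists_approximate_solution {T : ℝ} (hT : 0 < T) {φ Fp Fm : ℝ → ℝ}
    (hφ : StrictMono φ) (hφc : Continuous φ) (hφs : Function.Surjective φ) (hφ0 : φ 0 = 0)
    (hFp : Monotone Fp) (hFpc : Continuous Fp)
    (hFm : Monotone Fm) (hFmc : Continuous Fm) {a b : ℝ} (hab : a ≤ b)
    {g : ℝ → ℝ → ℝ} {Γ : ℝ → ℝ} (hgm : Measurable (Function.uncurry g))
    (hgc : ∀ t, Continuous (g t)) (hΓ : Integrable Γ) (hgΓ : ∀ t x, |g t x| ≤ Γ t)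
    (hga : ∀ t, 0 ≤ g t a) (hgb : ∀ t, g t b ≤ 0) :
    ∃ D C : ℝ, 0 ≤ D ∧ ∀ n : ℕ, ∃ (y d x z σ : ℝ → ℝ) (c : ℝ),
      Measurable x ∧ Measurable d ∧ |c| ≤ C ∧ (∀ t, x t ∈ Icc a b) ∧
      (∀ t ∈ Ico 0 T, |d t| ≤ D ∧ |x t - y t| ≤ D * (T / (n + 1)) ∧
        |z t - y t| ≤ D * (T / (n + 1)) ∧ |σ t - t| ≤ T / (n + 1) ∧
        φ (d t) + Fp (z t) - Fm (x t) + ∫ s in (0 : ℝ)..σ t, g s (x s) = c) ∧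
      (∀ t ∈ Icc 0 T, y t = y 0 + ∫ s in (0 : ℝ)..t, d s) ∧
      (∀ s t, IntervalIntegrable d volume s t) ∧
      y 0 ∈ Icc a b ∧ y T = y 0 ∧ ∫ s in (0 : ℝ)..T, g s (x s) = 0 := by
  obtain ⟨Sp, hSp⟩ : ∃ S, ∀ x ∈ Icc a b, |Fp x| ≤ S :=
    isCompact_Icc.exists_bound_of_continuousOn hFpc.continuousOn
  obtain ⟨Sm, hSm⟩ : ∃ S, ∀ x ∈ Icc a b, |Fm x| ≤ S :=
    isCompact_Icc.exists_bound_of_continuousOn hFmc.continuousOn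
  set L := Sp + Sm + ∫ t, Γ t with hL
  obtain ⟨D₁, hD₁⟩ := hφs (2 * L)
  obtain ⟨D₂, hD₂⟩ := hφs (-(2 * L))
  refine ⟨max |D₁| |D₂|, L, le_max_of_le_left (abs_nonneg _), fun n => ?_⟩
  set D := max |D₁| |D₂| with hD
  set δ := T / (n + 1) with hδdef
  have hδ : 0 < δ := by positivity
  have hNδ : ((n + 1 : ℕ) : ℝ) * δ = T := by
    rw [hδdef]; push_cast; field_simp
  have hgx : ∀ x : ℝ → ℝ, Measurable x → Measurable fun t => g t (x t) := fun x hx =>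
    hgm.comp (measurable_id.prodMk hx)
  have hgint : ∀ x : ℝ → ℝ, Measurable x → Integrable fun t => g t (x t) := fun x hx =>
    hΓ.mono' (hgx x hx).aestronglyMeasurable (Eventually.of_forall fun t => hgΓ t _)
  set H : ℕ → ℝ → ℝ := fun k r => ∫ t in (k * δ)..((k + 1 : ℕ) * δ), g t r with hH
  have hkle : ∀ k : ℕ, (k : ℝ) * δ ≤ (k + 1 : ℕ) * δ := fun k => by push_cast; nlinarith
  obtain ⟨U, c, hUab, hUper, hUeq, hUsum⟩ :=
    exists_periodic_difference_solution (n + 1) hφ.monotone hφc hFp hFpc hFm hFmc hδ hab (H := H)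
      (fun k => intervalIntegral.continuous_of_dominated_interval (bound := Γ)
        (fun r => (hgx _ measurable_const).aestronglyMeasurable)
        (fun r => Eventually.of_forall fun t _ => hgΓ t r) hΓ.intervalIntegrable
        (Eventually.of_forall fun t _ => hgc t))
      (fun k => intervalIntegral.integral_nonneg (hkle k) fun t _ => hga t)
      (fun k => by
        have := intervalIntegral.integral_nonneg (μ := volume) (f := fun t => -g t b) (hkle k)
          fun t _ => neg_nonneg.2 (hgb t)
        rw [intervalIntegral.integral_neg] at this
        exact neg_nonneg.1 this)
  have hfloor : Measurable fun t : ℝ => ⌊t / δ⌋₊ :=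
    Nat.measurable_floor.comp (measurable_id.div_const δ)
  set x : ℝ → ℝ := fun t => U ⌊t / δ⌋₊ with hx
  set d : ℝ → ℝ := fun t => (U (⌊t / δ⌋₊ + 1) - U ⌊t / δ⌋₊) / δ with hd
  have hxm : Measurable x := (measurable_from_nat (f := U)).comp hfloor
  have hdm : Measurable d :=
    (measurable_from_nat (f := fun k => (U (k + 1) - U k) / δ)).comp hfloor
  have hxint := hgint x hxm
  have hHsum : ∀ k : ℕ, ∑ j ∈ Finset.range k, H j (U j) = ∫ s in (0 : ℝ)..k * δ, g s (x s) :=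
    fun k => (integral_floor_step hδ (fun j t => g t (U j))
      (fun _ _ => hxint.intervalIntegrable) k).symm
  have hdint : ∀ s t, IntervalIntegrable d volume s t := by
    intro s t
    refine (intervalIntegrable_const (c := (b - a) / δ)).mono_fun' hdm.aestronglyMeasurable
      (Eventually.of_forall fun t => ?_)
    simp only [hd, Real.norm_eq_abs]
    rw [abs_div, abs_of_pos hδ]
    gcongr
    have h1 := hUab ⌊t / δ⌋₊
    have h2 := hUab (⌊t / δ⌋₊ + 1)
    rw [abs_le]
    constructor <;> linarith [h1.1, h1.2, h2.1, h2.2]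
  have hdsum : ∀ k : ℕ, U k = U 0 + ∫ s in (0 : ℝ)..k * δ, d s := by
    intro k
    have := integral_floor_step hδ (fun j _ => (U (j + 1) - U j) / δ) hdint k
    rw [hd, this]
    have h2 : ∀ j : ℕ, ∫ _ in (j * δ)..((j + 1 : ℕ) * δ), (U (j + 1) - U j) / δ =
        U (j + 1) - U j := by
      intro j
      rw [intervalIntegral.integral_const, smul_eq_mul]
      push_cast
      field_simp
      ring
    simp only [h2, Finset.sum_range_sub]
    ring
  have hintle : ∀ p q, |∫ s in p..q, g s (x s)| ≤ ∫ t, Γ t := by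
    intro p q
    have hΓ0 : ∀ t, 0 ≤ Γ t := fun t => (abs_nonneg _).trans (hgΓ t 0)
    calc |∫ s in p..q, g s (x s)| ≤ ∫ s in uIoc p q, |g s (x s)| :=
          intervalIntegral.norm_integral_le_integral_norm_uIoc (f := fun s => g s (x s))
      _ ≤ ∫ s in uIoc p q, Γ s :=
          setIntegral_mono hxint.abs.integrableOn hΓ.integrableOn fun t => hgΓ t _
      _ ≤ ∫ s, Γ s := setIntegral_le_integral hΓ (Eventually.of_forall hΓ0)
  have hclose : ∀ k < n + 1, |φ ((U (k + 1) - U k) / δ) - c| ≤ L := by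
    intro k hk
    have h1 := hUeq k hk
    rw [hHsum] at h1
    have h2 := abs_le.1 (hintle 0 ((k + 1 : ℕ) * δ))
    have h3 := abs_le.1 (hSp _ (hUab (k + 1)))
    have h4 := abs_le.1 (hSm _ (hUab k))
    rw [abs_le]
    constructor <;> linarith [h2.1, h2.2, h3.1, h3.2, h4.1, h4.2]
  have hsum0 : ∑ k ∈ Finset.range (n + 1), (U (k + 1) - U k) = 0 := by
    rw [Finset.sum_range_sub, hUper, sub_self]
  have hc : |c| ≤ L := by
    obtain ⟨i, hi, hi'⟩ := Finset.exists_le_of_sum_le (s := Finset.range (n + 1))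
      (f := fun k => U (k + 1) - U k) (g := fun _ => (0 : ℝ)) (by simp) (by rw [hsum0]; simp)
    obtain ⟨j, hj, hj'⟩ := Finset.exists_le_of_sum_le (s := Finset.range (n + 1))
      (f := fun _ => (0 : ℝ)) (g := fun k => U (k + 1) - U k) (by simp) (by rw [hsum0]; simp)
    have h1 : φ ((U (i + 1) - U i) / δ) ≤ 0 := by
      rw [← hφ0]; exact hφ.monotone (div_nonpos_of_nonpos_of_nonneg hi' hδ.le)
    have h2 : 0 ≤ φ ((U (j + 1) - U j) / δ) := by
      rw [← hφ0]; exact hφ.monotone (div_nonneg hj' hδ.le)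
    have h3 := abs_le.1 (hclose i (Finset.mem_range.1 hi))
    have h4 := abs_le.1 (hclose j (Finset.mem_range.1 hj))
    rw [abs_le]
    constructor <;> linarith [h3.1, h3.2, h4.1, h4.2]
  have hUD : ∀ k < n + 1, |(U (k + 1) - U k) / δ| ≤ D := by
    intro k hk
    have h1 := abs_le.1 (hclose k hk)
    have h2 := abs_le.1 hc
    have h3 : (U (k + 1) - U k) / δ ≤ D₁ := hφ.le_iff_le.1 (by rw [hD₁]; linarith [h1.2, h2.2])
    have h4 : D₂ ≤ (U (k + 1) - U k) / δ := hφ.le_iff_le.1 (by rw [hD₂]; linarith [h1.1, h2.1])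
    rw [abs_le]
    constructor
    · have := (neg_abs_le D₂); have := le_max_right |D₁| |D₂|; linarith
    · have := (le_abs_self D₁); have := le_max_left |D₁| |D₂|; linarith
  have hkey : ∀ t ∈ Ico 0 T, ⌊t / δ⌋₊ < n + 1 ∧ ⌊t / δ⌋₊ * δ ≤ t ∧
      t < (⌊t / δ⌋₊ + 1 : ℕ) * δ := by
    intro t ht
    have h0 : 0 ≤ t / δ := div_nonneg ht.1 hδ.le
    refine ⟨?_, ?_, ?_⟩
    · rw [Nat.floor_lt h0, div_lt_iff₀ hδ, hNδ]; exact ht.2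
    · rw [← le_div_iff₀ hδ]; exact Nat.floor_le h0
    · rw [← div_lt_iff₀ hδ]; exact_mod_cast Nat.lt_floor_add_one _
  have hdD : ∀ t ∈ Ico 0 T, |d t| ≤ D := fun t ht => hUD _ (hkey t ht).1
  refine ⟨fun t => U 0 + ∫ s in (0 : ℝ)..t, d s, d, x, fun t => U (⌊t / δ⌋₊ + 1),
    fun t => (⌊t / δ⌋₊ + 1 : ℕ) * δ, c, hxm, hdm, hc, fun t => hUab _, fun t ht => ?_,
    fun t _ => by simp, hdint, by simpa using hUab 0, ?_, ?_⟩
  · obtain ⟨h1, h2, h3⟩ := hkey t ht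
    have hstep : ((⌊t / δ⌋₊ + 1 : ℕ) : ℝ) * δ = ⌊t / δ⌋₊ * δ + δ := by push_cast; ring
    have hupT : ((⌊t / δ⌋₊ + 1 : ℕ) : ℝ) * δ ≤ T := by
      rw [← hNδ]; gcongr; omega
    have h0 : (0 : ℝ) ≤ ⌊t / δ⌋₊ * δ := by positivity
    have hD0 : 0 ≤ D := le_max_of_le_left (abs_nonneg _)
    refine ⟨hdD t ht, ?_, ?_, ?_, ?_⟩
    · have e : x t - (U 0 + ∫ s in (0 : ℝ)..t, d s) = -∫ s in (⌊t / δ⌋₊ * δ)..t, d s := by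
        rw [hx]
        simp only
        rw [hdsum ⌊t / δ⌋₊,
          ← intervalIntegral.integral_add_adjacent_intervals
            (hdint 0 (⌊t / δ⌋₊ * δ)) (hdint _ t)]
        ring
      rw [e, abs_neg]
      refine (abs_integral_le_mul_of_bound h2 fun s hs =>
        hdD s ⟨h0.trans hs.1.le, hs.2.trans ht.2⟩).trans ?_
      gcongr
      linarith
    · have e : U (⌊t / δ⌋₊ + 1) - (U 0 + ∫ s in (0 : ℝ)..t, d s) =
          ∫ s in t..((⌊t / δ⌋₊ + 1 : ℕ) * δ), d s := by
        rw [hdsum (⌊t / δ⌋₊ + 1),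
          ← intervalIntegral.integral_add_adjacent_intervals (hdint 0 t) (hdint _ _)]
        ring
      rw [e]
      refine (abs_integral_le_mul_of_bound h3.le fun s hs =>
        hdD s ⟨ht.1.trans hs.1.le, hs.2.trans_le hupT⟩).trans ?_
      gcongr
      linarith
    · rw [abs_le]
      constructor <;> linarith
    · rw [← hHsum]
      exact hUeq _ h1
  · have := hdsum (n + 1)
    rw [hNδ, hUper] at this
    simp [← this]
  · have := hHsum (n + 1)
    rw [hNδ, hUsum] at this
    exact this.symm

theorem exists_subseq_tendsto_of_lipschitz {T D M : ℝ} (hT : 0 ≤ T) (hD : 0 ≤ D) (v : ℕ → ℝ → ℝ)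
    (hlip : ∀ n, ∀ s ∈ Icc 0 T, ∀ t ∈ Icc 0 T, |v n s - v n t| ≤ D * |s - t|)
    (hbd : ∀ n, ∀ t ∈ Icc 0 T, |v n t| ≤ M) :
    ∃ (k : ℕ → ℕ) (u : ℝ → ℝ), StrictMono k ∧ Continuous u ∧
      ∀ t ∈ Icc 0 T, Tendsto (fun n => v (k n) t) atTop (𝓝 (u t)) := by
  have hL : ∀ n, LipschitzWith D.toNNReal (fun t : Icc (0 : ℝ) T => v n t) := fun n =>
    LipschitzWith.of_dist_le_mul fun s t => by
      rw [Real.dist_eq, Real.coe_toNNReal D hD, Subtype.dist_eq, Real.dist_eq]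
      exact hlip n s s.2 t t.2
  set V : ℕ → BoundedContinuousFunction (Icc (0 : ℝ) T) ℝ := fun n =>
    BoundedContinuousFunction.mkOfCompact ⟨fun t => v n t, (hL n).continuous⟩ with hV
  have hcomp : IsCompact (closure (range V)) := by
    refine BoundedContinuousFunction.arzela_ascoli (Icc (-M) M) isCompact_Icc _ ?_ ?_
    · rintro _ t ⟨n, rfl⟩
      exact abs_le.1 (hbd n t t.2)
    · refine (LipschitzWith.uniformEquicontinuous _ D.toNNReal ?_).equicontinuous
      rintro ⟨_, n, rfl⟩
      exact hL n
  obtain ⟨w, -, k, hk, hlim⟩ :=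
    hcomp.tendsto_subseq (x := V) fun n => subset_closure (mem_range_self n)
  refine ⟨k, IccExtend hT w, hk, w.continuous.Icc_extend', fun t ht => ?_⟩
  rw [IccExtend_of_mem hT _ ht]
  exact ((continuous_eval_const (⟨t, ht⟩ : Icc (0 : ℝ) T)).tendsto w).comp hlim

theorem exists_periodic_solution_of_bounded {T : ℝ} (hT : 0 < T) {φ Fp Fm : ℝ → ℝ}
    (hφ : StrictMono φ) (hφc : Continuous φ) (hφs : Function.Surjective φ) (hφ0 : φ 0 = 0)
    (hFp : Monotone Fp) (hFpc : Continuous Fp)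
    (hFm : Monotone Fm) (hFmc : Continuous Fm) {a b : ℝ} (hab : a ≤ b)
    {g : ℝ → ℝ → ℝ} {Γ : ℝ → ℝ} (hgm : Measurable (Function.uncurry g))
    (hgc : ∀ t, Continuous (g t)) (hΓ : Integrable Γ) (hgΓ : ∀ t x, |g t x| ≤ Γ t)
    (hga : ∀ t, 0 ≤ g t a) (hgb : ∀ t, g t b ≤ 0) :
    ∃ (u u' : ℝ → ℝ) (c : ℝ), Continuous u ∧ Continuous u' ∧ (∀ t ∈ Icc 0 T, u t ∈ Icc a b) ∧
      (∀ t ∈ Icc 0 T, u t = u 0 + ∫ s in (0 : ℝ)..t, u' s) ∧ u 0 = u T ∧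
      (∀ t, φ (u' t) + (Fp (u t) - Fm (u t)) + ∫ s in (0 : ℝ)..t, g s (u s) = c) ∧
      ∫ s in (0 : ℝ)..T, g s (u s) = 0 := by
  obtain ⟨D, C, hD, happ⟩ := exists_approximate_solution hT hφ hφc hφs hφ0 hFp hFpc hFm hFmc hab
    hgm hgc hΓ hgΓ hga hgb
  choose y d x z σ c hxm hdm hc hxab happ' hy hdint hy0 hyT hgx0 using happ
  have hlip : ∀ n, ∀ s ∈ Icc 0 T, ∀ t ∈ Icc 0 T, |y n s - y n t| ≤ D * |s - t| := by
    intro n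
    have key : ∀ s ∈ Icc 0 T, ∀ t ∈ Icc 0 T, s ≤ t → |y n t - y n s| ≤ D * (t - s) := by
      intro s hs t ht hst
      have e : y n t - y n s = ∫ r in s..t, d n r := by
        rw [hy n t ht, hy n s hs,
          ← intervalIntegral.integral_add_adjacent_intervals (hdint n 0 s) (hdint n s t)]
        ring
      rw [e]
      exact abs_integral_le_mul_of_bound hst fun r hr =>
        (happ' n r ⟨hs.1.trans hr.1.le, hr.2.trans_le ht.2⟩).1
    intro s hs t ht
    rcases le_total s t with hst | hst
    · rw [abs_sub_comm, abs_sub_comm s t, abs_of_nonneg (sub_nonneg.2 hst)]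
      exact key s hs t ht hst
    · rw [abs_of_nonneg (sub_nonneg.2 hst)]
      exact key t ht s hs hst
  have h0T : (0 : ℝ) ∈ Icc 0 T := ⟨le_rfl, hT.le⟩
  have hTT : T ∈ Icc 0 T := ⟨hT.le, le_rfl⟩
  have hbd : ∀ n, ∀ t ∈ Icc 0 T, |y n t| ≤ max |a| |b| + D * T := by
    intro n t ht
    have h1 := hlip n t ht 0 h0T
    have h2 : |y n 0| ≤ max |a| |b| := abs_le_max_abs_abs (hy0 n).1 (hy0 n).2
    have h3 : D * |t - 0| ≤ D * T := by
      rw [sub_zero, abs_of_nonneg ht.1]; exact mul_le_mul_of_nonneg_left ht.2 hD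
    have h4 := abs_sub_abs_le_abs_sub (y n t) (y n 0)
    linarith
  obtain ⟨k₁, u, hk₁, hu, hlim₁⟩ := exists_subseq_tendsto_of_lipschitz hT.le hD y hlip hbd
  obtain ⟨c', -, k₂, hk₂, hclim⟩ := (isCompact_Icc (a := -C) (b := C)).tendsto_subseq
    (x := fun n => c (k₁ n)) fun n => abs_le.1 (hc (k₁ n))
  set k := fun n => k₁ (k₂ n) with hk
  have hkt : Tendsto k atTop atTop := (hk₁.comp hk₂).tendsto_atTop
  have hylim : ∀ t ∈ Icc 0 T, Tendsto (fun n => y (k n) t) atTop (𝓝 (u t)) := fun t ht =>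
    (hlim₁ t ht).comp hk₂.tendsto_atTop
  have hδlim : Tendsto (fun n => T / ((k n : ℝ) + 1)) atTop (𝓝 0) :=
    (tendsto_const_div_atTop_nhds_zero_nat T |>.comp
      ((tendsto_add_atTop_nat 1).comp hkt)).congr fun n => by simp
  have hDδlim : Tendsto (fun n => D * (T / ((k n : ℝ) + 1))) atTop (𝓝 0) := by
    simpa using hδlim.const_mul D
  have hxlim : ∀ t ∈ Ico 0 T, Tendsto (fun n => x (k n) t) atTop (𝓝 (u t)) := by
    intro t ht
    have h1 : Tendsto (fun n => x (k n) t - y (k n) t) atTop (𝓝 0) :=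
      squeeze_zero_norm (fun n => (happ' (k n) t ht).2.1) hDδlim
    simpa using h1.add (hylim t ⟨ht.1, ht.2.le⟩)
  have hzlim : ∀ t ∈ Ico 0 T, Tendsto (fun n => z (k n) t) atTop (𝓝 (u t)) := by
    intro t ht
    have h1 : Tendsto (fun n => z (k n) t - y (k n) t) atTop (𝓝 0) :=
      squeeze_zero_norm (fun n => (happ' (k n) t ht).2.2.1) hDδlim
    simpa using h1.add (hylim t ⟨ht.1, ht.2.le⟩)
  have hσlim : ∀ t ∈ Ico 0 T, Tendsto (fun n => σ (k n) t) atTop (𝓝 t) := by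
    intro t ht
    have h1 : Tendsto (fun n => σ (k n) t - t) atTop (𝓝 0) :=
      squeeze_zero_norm (fun n => (happ' (k n) t ht).2.2.2.1) hδlim
    simpa using h1.add_const t
  have hneT : ∀ᵐ t : ℝ ∂volume, t ≠ T := by
    simp [ae_iff, measure_singleton]
  have hgm' : ∀ w : ℝ → ℝ, Measurable w → Measurable fun t => g t (w t) := fun w hw =>
    hgm.comp (measurable_id.prodMk hw)
  have hgint : ∀ w : ℝ → ℝ, Measurable w → Integrable fun t => g t (w t) := fun w hw =>
    hΓ.mono' (hgm' w hw).aestronglyMeasurable (Eventually.of_forall fun t => hgΓ t _)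
  have hGlim : ∀ t ∈ Icc 0 T, Tendsto (fun n => ∫ s in (0 : ℝ)..t, g s (x (k n) s)) atTop
      (𝓝 (∫ s in (0 : ℝ)..t, g s (u s))) := by
    intro t ht
    refine intervalIntegral.tendsto_integral_filter_of_dominated_convergence Γ
      (Eventually.of_forall fun n => (hgm' _ (hxm _)).aestronglyMeasurable)
      (Eventually.of_forall fun n => Eventually.of_forall fun s _ => hgΓ s _)
      hΓ.intervalIntegrable ?_
    filter_upwards [hneT] with s hs hmem
    rw [uIoc_of_le ht.1] at hmem
    exact ((hgc s).tendsto _).comp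
      (hxlim s ⟨hmem.1.le, lt_of_le_of_ne (hmem.2.trans ht.2) hs⟩)
  have hGσlim : ∀ t ∈ Ico 0 T, Tendsto (fun n => ∫ s in (0 : ℝ)..σ (k n) t, g s (x (k n) s)) atTop
      (𝓝 (∫ s in (0 : ℝ)..t, g s (u s))) := by
    intro t ht
    have hprim : Continuous fun r => ∫ s in t..r, Γ s :=
      intervalIntegral.continuous_primitive (fun _ _ => hΓ.intervalIntegrable) t
    have h1 : Tendsto (fun n => |∫ s in t..σ (k n) t, Γ s|) atTop (𝓝 0) := by
      have := (hprim.abs.tendsto t).comp (hσlim t ht)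
      simpa [Function.comp_def] using this
    have h2 : Tendsto (fun n => ∫ s in t..σ (k n) t, g s (x (k n) s)) atTop (𝓝 0) :=
      squeeze_zero_norm (fun n => intervalIntegral.norm_integral_le_abs_of_norm_le
        (Eventually.of_forall fun s => hgΓ s _) hΓ.intervalIntegrable) h1
    have h3 := (hGlim t ⟨ht.1, ht.2.le⟩).add h2
    rw [add_zero] at h3
    refine h3.congr fun n => ?_
    exact intervalIntegral.integral_add_adjacent_intervals
      (hgint _ (hxm _)).intervalIntegrable (hgint _ (hxm _)).intervalIntegrable
  set e := hφ.orderIsoOfSurjective φ hφs with he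
  have hec : Continuous e.symm := e.symm.continuous
  have heφ : ∀ r, e.symm (φ r) = r := fun r => e.symm_apply_apply r
  have hφe : ∀ r, φ (e.symm r) = r := fun r => e.apply_symm_apply r
  set u' : ℝ → ℝ := fun t => e.symm (c' - (Fp (u t) - Fm (u t)) - ∫ s in (0 : ℝ)..t, g s (u s))
    with hu'
  have hu'c : Continuous u' := by
    have h1 : Continuous fun t => ∫ s in (0 : ℝ)..t, g s (u s) :=
      intervalIntegral.continuous_primitive
        (fun _ _ => (hgint u hu.measurable).intervalIntegrable) 0
    exact hec.comp (by fun_prop)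
  have hdlim : ∀ t ∈ Ico 0 T, Tendsto (fun n => d (k n) t) atTop (𝓝 (u' t)) := by
    intro t ht
    have h1 : Tendsto (fun n => c (k n) - (Fp (z (k n) t) - Fm (x (k n) t)) -
        ∫ s in (0 : ℝ)..σ (k n) t, g s (x (k n) s)) atTop
        (𝓝 (c' - (Fp (u t) - Fm (u t)) - ∫ s in (0 : ℝ)..t, g s (u s))) :=
      (hclim.sub (((hFpc.tendsto _).comp (hzlim t ht)).sub
        ((hFmc.tendsto _).comp (hxlim t ht)))).sub (hGσlim t ht)
    refine ((hec.tendsto _).comp h1).congr fun n => ?_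
    rw [Function.comp_apply, ← heφ (d (k n) t)]
    congr 1
    linarith [(happ' (k n) t ht).2.2.2.2]
  have huT : u 0 = u T :=
    tendsto_nhds_unique (hylim 0 h0T) ((hylim T hTT).congr fun n => hyT _)
  have huab : ∀ t ∈ Ico 0 T, u t ∈ Icc a b := fun t ht =>
    isClosed_Icc.mem_of_tendsto (hxlim t ht) (Eventually.of_forall fun n => hxab _ t)
  refine ⟨u, u', c', hu, hu'c, fun t ht => ?_, fun t ht => ?_, huT, fun t => ?_, ?_⟩
  · rcases eq_or_lt_of_le ht.2 with rfl | hlt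
    · rw [← huT]; exact huab 0 ⟨le_rfl, hT⟩
    · exact huab t ⟨ht.1, hlt⟩
  · refine tendsto_nhds_unique (hylim t ht) (((hylim 0 h0T).add ?_).congr
      fun n => (hy (k n) t ht).symm)
    refine intervalIntegral.tendsto_integral_filter_of_dominated_convergence (fun _ => D)
      (Eventually.of_forall fun n => (hdm _).aestronglyMeasurable)
      (Eventually.of_forall fun n => ?_) intervalIntegrable_const ?_
    · filter_upwards [hneT] with s hs hmem
      rw [uIoc_of_le ht.1] at hmem
      exact (happ' (k n) s ⟨hmem.1.le, lt_of_le_of_ne (hmem.2.trans ht.2) hs⟩).1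
    · filter_upwards [hneT] with s hs hmem
      rw [uIoc_of_le ht.1] at hmem
      exact hdlim s ⟨hmem.1.le, lt_of_le_of_ne (hmem.2.trans ht.2) hs⟩
  · rw [hu']
    simp only [hφe]
    ring
  · exact tendsto_nhds_unique ((hGlim T hTT).congr fun n => hgx0 _) tendsto_const_nhds

theorem exists_first_zero {p : ℝ → ℝ} {l r q : ℝ} (hp : ContinuousOn p (Icc l r)) (hl : 0 < p l)
    (hq : q ∈ Icc l r) (hpq : p q ≤ 0) :
    ∃ e ∈ Ioc l r, p e = 0 ∧ ∀ s ∈ Ico l e, 0 < p s := by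
  set Z : Set ℝ := Icc l r ∩ p ⁻¹' Iic 0 with hZ
  have hZc : IsClosed Z := hp.preimage_isClosed_of_isClosed isClosed_Icc isClosed_Iic
  have hZb : BddBelow Z := ⟨l, fun s hs => hs.1.1⟩
  have heZ : sInf Z ∈ Z := hZc.csInf_mem ⟨q, hq, hpq⟩ hZb
  set e := sInf Z with he
  have hle : l < e := lt_of_le_of_ne heZ.1.1 fun h => by
    have : p e ≤ 0 := heZ.2
    rw [← h] at this
    linarith
  have hpos : ∀ s ∈ Ico l e, 0 < p s := by
    intro s hs
    by_contra! hneg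
    exact absurd (csInf_le hZb ⟨⟨hs.1, hs.2.le.trans heZ.1.2⟩, hneg⟩) (not_le.2 hs.2)
  refine ⟨e, ⟨hle, heZ.1.2⟩, le_antisymm heZ.2 ?_, hpos⟩
  have : NeBot (𝓝[Ico l e] e) := by
    rw [nhdsWithin_Ico_eq_nhdsLT hle]; infer_instance
  exact ge_of_tendsto ((hp e heZ.1).mono_left (nhdsWithin_mono _ fun s hs =>
    (⟨hs.1, hs.2.le.trans heZ.1.2⟩ : s ∈ Icc l r)))
    (eventually_nhdsWithin_of_forall fun s hs => (hpos s hs).le)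

theorem deriv_nonpos_of_pos_left {p : ℝ → ℝ} {p' l e : ℝ} {S : Set ℝ} (hle : l < e)
    (hS : Ico l e ⊆ S) (hd : HasDerivWithinAt p p' S e) (he : p e = 0)
    (hpos : ∀ s ∈ Ico l e, 0 < p s) : p' ≤ 0 := by
  have hne : NeBot (𝓝[Ico l e] e) := by
    rw [nhdsWithin_Ico_eq_nhdsLT hle]; infer_instance
  refine le_of_tendsto ((hasDerivWithinAt_iff_tendsto_slope' (by simp)).1 (hd.mono hS))
    (eventually_nhdsWithin_of_forall fun s hs => ?_)
  rw [slope_def_field, he, sub_zero]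
  exact div_nonpos_of_nonneg_of_nonpos (hpos s hs).le (sub_nonpos.2 hs.2.le)

/-- A comparison principle on a period: if `Φ` increases strictly wherever `p > 0`, and
at the zeros of `p` the sign of `Φ` follows that of `p'`, then `p ≤ 0`. -/
theorem nonpos_of_periodic_comparison {T : ℝ} (hT : 0 < T) {p p' Φ : ℝ → ℝ}
    (hp : ∀ t ∈ Icc (0 : ℝ) T, HasDerivWithinAt p (p' t) (Icc (0 : ℝ) T) t)
    (hpT : p 0 = p T) (hΦT : Φ 0 = Φ T)
    (hneg : ∀ t ∈ Icc (0 : ℝ) T, p t = 0 → p' t ≤ 0 → Φ t ≤ 0)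
    (hpos : ∀ t ∈ Icc (0 : ℝ) T, p t = 0 → 0 ≤ p' t → 0 ≤ Φ t)
    (hmono : ∀ s ∈ Icc (0 : ℝ) T, ∀ t ∈ Icc (0 : ℝ) T, s < t → (∀ r ∈ Ioo s t, 0 < p r) →
      Φ s < Φ t) :
    ∀ t ∈ Icc (0 : ℝ) T, p t ≤ 0 := by
  have hpc : ContinuousOn p (Icc 0 T) := fun t ht => (hp t ht).continuousWithinAt
  have hright : ∀ t ∈ Icc (0 : ℝ) T, 0 < p t → ∀ q ∈ Icc t T, p q ≤ 0 → Φ t < 0 := by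
    intro t ht hpt q hq hpq
    obtain ⟨e, he, hpe, hlt⟩ := exists_first_zero
      (hpc.mono (Icc_subset_Icc_left ht.1)) hpt hq hpq
    have heT : e ∈ Icc 0 T := ⟨ht.1.trans he.1.le, he.2⟩
    have h1 := hneg e heT hpe (deriv_nonpos_of_pos_left (S := Icc 0 T) he.1
      (fun s hs => ⟨ht.1.trans hs.1, hs.2.le.trans he.2⟩) (hp e heT) hpe hlt)
    exact (hmono t ht e heT he.1 fun r hr => hlt r ⟨hr.1.le, hr.2⟩).trans_le h1
  have hleft : ∀ t ∈ Icc (0 : ℝ) T, 0 < p t → ∀ q ∈ Icc 0 t, p q ≤ 0 → 0 < Φ t := by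
    intro t ht hpt q hq hpq
    have hneg_maps : MapsTo (fun s : ℝ => -s) (Icc (-t) 0) (Icc 0 T) := fun s hs =>
      ⟨by linarith [hs.2], by linarith [hs.1, ht.2]⟩
    obtain ⟨e, he, hpe, hlt⟩ := exists_first_zero (p := fun s => p (-s)) (l := -t) (r := 0)
      (q := -q) (hpc.comp continuous_neg.continuousOn hneg_maps) (by simpa using hpt)
      ⟨by linarith [hq.2], by linarith [hq.1]⟩ (by simpa using hpq)
    have heT : -e ∈ Icc 0 T := hneg_maps ⟨he.1.le, he.2⟩
    have hd : HasDerivWithinAt (fun s => p (-s)) (-(p' (-e))) (Icc (-t) 0) e := by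
      simpa [Function.comp_def] using (hp (-e) heT).scomp e
        (hasDerivAt_neg e).hasDerivWithinAt hneg_maps
    have h0 := deriv_nonpos_of_pos_left (S := Icc (-t) 0) he.1
      (fun s hs => ⟨hs.1, hs.2.le.trans he.2⟩) hd hpe hlt
    have h1 := hpos (-e) heT hpe (by linarith)
    refine h1.trans_lt (hmono (-e) heT t ht (by linarith [he.1]) fun r hr => ?_)
    have := hlt (-r) ⟨by linarith [hr.2], by linarith [hr.1]⟩
    simpa using this
  have h0T : (0 : ℝ) ∈ Icc 0 T := ⟨le_rfl, hT.le⟩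
  have hTT : T ∈ Icc 0 T := ⟨hT.le, le_rfl⟩
  have hp0 : p 0 ≤ 0 := by
    by_contra! hp0
    by_cases hall : ∀ q ∈ Icc 0 T, 0 < p q
    · exact (hmono 0 h0T T hTT hT fun r hr => hall r ⟨hr.1.le, hr.2.le⟩).ne hΦT
    · push Not at hall
      obtain ⟨q, hq, hpq⟩ := hall
      have h1 := hright 0 h0T hp0 q hq hpq
      have h2 := hleft T hTT (hpT ▸ hp0) q hq hpq
      linarith
  intro t ht
  by_contra! hpt
  have h1 := hright t ht hpt T ⟨ht.2, le_rfl⟩ (hpT ▸ hp0)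
  have h2 := hleft t ht hpt 0 ⟨le_rfl, ht.1⟩ hp0
  linarith

theorem IsC1Periodic.continuousOn {T : ℝ} {v v' : ℝ → ℝ} (hv : IsC1Periodic T v v') :
    ContinuousOn v (Icc 0 T) := fun t ht => (hv.1 t ht).continuousWithinAt

theorem IsC1Periodic.integral_comp_mul_deriv {T : ℝ} {v v' G k : ℝ → ℝ} (hv : IsC1Periodic T v v')
    (hk : Continuous k) (hG : ∀ x, HasDerivAt G (k x) x) {s t : ℝ} (hs : 0 ≤ s) (hst : s ≤ t)
    (ht : t ≤ T) :
    IntervalIntegrable (fun r => k (v r) * v' r) volume s t ∧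
      ∫ r in s..t, k (v r) * v' r = G (v t) - G (v s) := by
  have hsub : Icc s t ⊆ Icc 0 T := Icc_subset_Icc hs ht
  have hint : IntervalIntegrable (fun r => k (v r) * v' r) volume s t :=
    (((hk.comp_continuousOn hv.continuousOn).mul hv.2.1).mono hsub).intervalIntegrable_of_Icc hst
  have hGc : Continuous G := continuous_iff_continuousAt.2 fun x => (hG x).continuousAt
  refine ⟨hint, intervalIntegral.integral_eq_sub_of_hasDeriv_right_of_le
    (f := fun r => G (v r)) hst (hGc.comp_continuousOn (hv.continuousOn.mono hsub))
    (fun r hr => ?_) hint⟩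
  have hd := (hv.1 r (hsub ⟨hr.1.le, hr.2.le⟩)).hasDerivAt
    (Icc_mem_nhds (hs.trans_lt hr.1) (hr.2.trans_le ht))
  exact ((hG (v r)).comp r hd).hasDerivWithinAt

theorem oscillation_le {T : ℝ} (hT : 0 ≤ T) {φ F u u' : ℝ → ℝ} {A s₀ c : ℝ}
    (hu : IsC1Periodic T u u') (hF : Continuous F)
    (hφ : ∀ r, (A + 1) * (|r| - s₀) ≤ φ r * r)
    (hA : ∀ t ∈ Icc 0 T, |φ (u' t) + F (u t) - c| ≤ A) :
    ∀ s ∈ Icc 0 T, ∀ t ∈ Icc 0 T, u t ≤ u s + (A + 1) * s₀ * T := by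
  have hFc : Continuous fun x => F x - c := by fun_prop
  obtain ⟨hint, hzero⟩ := hu.integral_comp_mul_deriv hFc
    (fun x => (hFc.integral_hasStrictDerivAt 0 x).hasDerivAt) le_rfl hT le_rfl
  rw [hu.2.2.1, sub_self] at hzero
  have hu'int : IntervalIntegrable u' volume 0 T := hu.2.1.intervalIntegrable_of_Icc hT
  have hbound : ∀ t ∈ Icc 0 T, |u' t| ≤ (A + 1) * s₀ - (F (u t) - c) * u' t := by
    intro t ht
    have h1 := hφ (u' t)
    have h2 : (φ (u' t) + F (u t) - c) * u' t ≤ A * |u' t| := by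
      refine (le_abs_self _).trans ?_
      rw [abs_mul]
      exact mul_le_mul_of_nonneg_right (hA t ht) (abs_nonneg _)
    linarith
  have htot : ∫ t in (0 : ℝ)..T, |u' t| ≤ (A + 1) * s₀ * T := by
    refine (intervalIntegral.integral_mono_on hT hu'int.abs
      (intervalIntegrable_const.sub hint) hbound).trans ?_
    rw [intervalIntegral.integral_sub intervalIntegrable_const hint, hzero]
    simp
    linarith
  have hdiff : ∀ s ∈ Icc 0 T, ∀ t ∈ Icc 0 T, s ≤ t → |u t - u s| ≤ (A + 1) * s₀ * T := by
    intro s hs t ht hst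
    have h := (hu.integral_comp_mul_deriv (k := fun _ => 1) (G := id) continuous_const
      (fun x => hasDerivAt_id x) hs.1 hst ht.2).2
    simp only [one_mul, id] at h
    rw [← h]
    refine (intervalIntegral.abs_integral_le_integral_abs hst).trans (le_trans ?_ htot)
    exact intervalIntegral.integral_mono_interval hs.1 hst ht.2
      (Eventually.of_forall fun _ => abs_nonneg _) hu'int.abs
  intro s hs t ht
  rcases le_total s t with hst | hst
  · linarith [(abs_le.1 (hdiff s hs t ht hst)).2]
  · linarith [(abs_le.1 (hdiff t ht s hs hst)).1]

theorem exists_coercivity_bound {φ : ℝ → ℝ} (hφ : StrictMono φ) (hφs : Function.Surjective φ)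
    (hφ0 : φ 0 = 0) {B : ℝ} (hB : 0 < B) : ∃ s₀, 0 ≤ s₀ ∧ ∀ r, B * (|r| - s₀) ≤ φ r * r := by
  obtain ⟨x, hx⟩ := hφs B
  obtain ⟨y, hy⟩ := hφs (-B)
  have hx0 : 0 < x := hφ.lt_iff_lt.1 (by rw [hx, hφ0]; exact hB)
  have hy0 : y < 0 := hφ.lt_iff_lt.1 (by rw [hy, hφ0]; linarith)
  refine ⟨x - y, by linarith, fun r => ?_⟩
  rcases le_total 0 r with hr | hr
  · rw [abs_of_nonneg hr]
    rcases le_total x r with h | h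
    · have := hφ.monotone h
      rw [hx] at this
      nlinarith
    · have := hφ.monotone hr
      rw [hφ0] at this
      nlinarith
  · rw [abs_of_nonpos hr]
    rcases le_total r y with h | h
    · have := hφ.monotone h
      rw [hy] at this
      nlinarith
    · have := hφ.monotone hr
      rw [hφ0] at this
      nlinarith

theorem monotone_integral_of_nonneg {k : ℝ → ℝ} (hk : Continuous k) (h0 : ∀ x, 0 ≤ k x) :
    Monotone fun x => ∫ s in (0 : ℝ)..x, k s := by
  intro x y hxy
  have := intervalIntegral.integral_nonneg (μ := volume) (f := k) hxy fun s _ => h0 s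
  rw [← intervalIntegral.integral_interval_sub_left (hk.intervalIntegrable 0 y)
    (hk.intervalIntegrable 0 x)] at this
  simpa using this

theorem integral_pos_of_ae_pos_on {k : ℝ → ℝ} {s t : ℝ} (hst : s < t)
    (hk : IntervalIntegrable k volume s t) (hpos : ∀ᵐ r ∂volume, r ∈ Ioo s t → 0 < k r) :
    0 < ∫ r in s..t, k r := by
  have hae : ∀ᵐ r ∂volume.restrict (Ioc s t), 0 < k r := by
    rw [← restrict_Ioo_eq_restrict_Ioc]
    exact (ae_restrict_iff' measurableSet_Ioo).2 hpos
  rw [intervalIntegral.integral_of_le hst.le,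
    integral_pos_iff_support_of_nonneg_ae (hae.mono fun r hr => hr.le) hk.1]
  have hsupp : Function.support k =ᵐ[volume.restrict (Ioc s t)] univ :=
    eventuallyEq_univ.2 (hae.mono fun r hr => hr.ne')
  rw [measure_congr hsupp]
  simp [hst]

/-- The modification of `h` outside the strip `-R ≤ x ≤ β t`. -/
def penalized (h : ℝ → ℝ → ℝ) (ρ β : ℝ → ℝ) (R t x : ℝ) : ℝ :=
  h t (max (-R - 1) (min x (β t))) - ρ t * min (max (x - β t) 0) 1 +
    ρ t * min (max (-R - x) 0) 1

theorem abs_penalized_le {h : ℝ → ℝ → ℝ} {ρ β : ℝ → ℝ} {R B t : ℝ} (hβ : |β t| ≤ B) (hBR : B ≤ R)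
    (hh : ∀ x, |x| ≤ R + 1 → |h t x| ≤ ρ t) (x : ℝ) : |penalized h ρ β R t x| ≤ 3 * ρ t := by
  have hβ' := abs_le.1 hβ
  have h1 := hh (max (-R - 1) (min x (β t))) (abs_le.2
    ⟨by linarith [le_max_left (-R - 1) (min x (β t))],
      max_le (by linarith) ((min_le_right _ _).trans (by linarith))⟩)
  have hρ : 0 ≤ ρ t := (abs_nonneg _).trans h1
  have hbd : ∀ y : ℝ, 0 ≤ ρ t * min (max y 0) 1 ∧ ρ t * min (max y 0) 1 ≤ ρ t := fun y =>
    ⟨mul_nonneg hρ (le_min (le_max_right _ _) zero_le_one),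
      mul_le_of_le_one_right hρ (min_le_right _ _)⟩
  have h2 := hbd (x - β t)
  have h3 := hbd (-R - x)
  have h4 := abs_le.1 h1
  unfold penalized
  rw [abs_le]
  constructor <;> linarith [h2.1, h2.2, h3.1, h3.2, h4.1, h4.2]

theorem penalized_of_le {h : ℝ → ℝ → ℝ} {ρ β : ℝ → ℝ} {R t x : ℝ} (hx : -R - 1 ≤ x)
    (hxβ : x ≤ β t) : penalized h ρ β R t x = h t x + ρ t * min (max (-R - x) 0) 1 := by
  simp [penalized, min_eq_left hxβ, max_eq_right hx, max_eq_right (sub_nonpos.2 hxβ)]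

theorem penalized_of_ge {h : ℝ → ℝ → ℝ} {ρ β : ℝ → ℝ} {R t x : ℝ} (hR : -R ≤ β t)
    (hxβ : β t ≤ x) : penalized h ρ β R t x = h t (β t) - ρ t * min (x - β t) 1 := by
  rw [penalized, min_eq_right hxβ, max_eq_right (by linarith), max_eq_left (sub_nonneg.2 hxβ),
    max_eq_right (by linarith : -R - x ≤ 0), min_eq_left zero_le_one]
  ring

/-- Existence below a strict upper solution: if `h` is Carathéodory, bounded from below by
`−γ` (condition `(A₁ᴵ)`), satisfies the Villari condition at `−∞` with `δ = 1`, and `β ∈ 𝔇`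
is a strict upper solution of `(φ(u'))' + f(u)u' + h(t,u) = 0`, then this equation has a
`T`-periodic solution `ũ` with `ũ < β` on `[0,T]`. -/
theorem statement6
    (T : ℝ) (hT : 0 < T)
    (φ f : ℝ → ℝ)
    (hφmono : StrictMono φ) (hφcont : Continuous φ)
    (hφsurj : Function.Surjective φ) (hφ0 : φ 0 = 0)
    (hf : Continuous f)
    (h : ℝ → ℝ → ℝ) (hCar : Caratheodory T h)
    (γ : ℝ → ℝ) (hγint : IntegrableOn γ (Icc (0:ℝ) T))
    (hγpos : ∀ᵐ t ∂(muT T), 0 ≤ γ t)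
    (hA1 : ∀ᵐ t ∂(muT T), ∀ u : ℝ, -γ t ≤ h t u)
    (hVillari : ∃ d₀ : ℝ, 0 < d₀ ∧ ∀ u u' : ℝ → ℝ, IsC1Periodic T u u' →
      (∀ t ∈ Icc (0:ℝ) T, u t ≤ -d₀) → 0 < ∫ t in Icc (0:ℝ) T, h t (u t))
    (β β' wβ : ℝ → ℝ)
    (hβ : IsC1Periodic T β β') (hβAC : IsACPhiDeriv T φ β' wβ)
    (hβineq : ∀ᵐ t ∂(muT T), wβ t + f (β t) * β' t + h t (β t) < 0)
    (hβstrict : ∀ u : ℝ → ℝ, IsSolE T φ f h u → (∀ t ∈ Icc (0:ℝ) T, u t ≤ β t) →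
      ∀ t ∈ Icc (0:ℝ) T, u t < β t) :
    ∃ u : ℝ → ℝ, IsSolE T φ f h u ∧ ∀ t ∈ Icc (0:ℝ) T, u t < β t := by
  obtain ⟨hCm, hCc, hCb⟩ := hCar
  obtain ⟨d₀, hd₀, hVil⟩ := hVillari
  have hβc := hβ.continuousOn
  obtain ⟨B, hB⟩ : ∃ B, ∀ t ∈ Icc 0 T, |β t| ≤ B :=
    isCompact_Icc.exists_bound_of_continuousOn hβc
  have h0T : (0 : ℝ) ∈ Icc 0 T := ⟨le_rfl, hT.le⟩
  have hTT : T ∈ Icc 0 T := ⟨hT.le, le_rfl⟩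
  have hB0 : 0 ≤ B := (abs_nonneg _).trans (hB 0 h0T)
  have hγii : IntervalIntegrable γ volume 0 T :=
    (intervalIntegrable_iff_integrableOn_Icc_of_le hT.le).2 hγint
  set A := 2 * ∫ t in (0 : ℝ)..T, γ t with hA
  have hA0 : 0 ≤ A := by
    have : 0 ≤ ∫ t in (0 : ℝ)..T, γ t :=
      intervalIntegral.integral_nonneg_of_ae_restrict hT.le hγpos
    linarith
  obtain ⟨s₀, hs₀, hcoer⟩ := exists_coercivity_bound hφmono hφsurj hφ0 (B := A + 1) (by linarith)
  set K := (A + 1) * s₀ * T with hK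
  have hK0 : 0 ≤ K := by positivity
  set R := max (d₀ + K) B with hR
  have hRd : d₀ + K ≤ R := le_max_left _ _
  have hRB : B ≤ R := le_max_right _ _
  obtain ⟨γR, hγRint, hγR⟩ := hCb (R + 1) (by linarith)
  set βe : ℝ → ℝ := IccExtend hT.le ((Icc 0 T).domRestrict β) with hβe
  have hβec : Continuous βe := (continuousOn_iff_continuous_domRestrict.1 hβc).Icc_extend'
  have hβeq : ∀ t ∈ Icc 0 T, βe t = β t := fun t ht => IccExtend_of_mem hT.le _ ht
  -- A measurable weight dominating both `γ` and `h` on the relevant strip.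
  have hρint₀ : IntegrableOn (fun t => γR t + γ t + 1) (Icc 0 T) :=
    (hγRint.add hγint).add (by simp)
  obtain ⟨ρ₀, hρ₀m, hρ₀⟩ := hρint₀.aestronglyMeasurable
  have hgood : ∀ᵐ t ∂volume.restrict (Icc 0 T), t ∈ Icc 0 T ∧ Continuous (h t) ∧
      (∀ x, |x| ≤ R + 1 → |h t x| ≤ γR t) ∧ 0 ≤ γ t ∧ (∀ x, -γ t ≤ h t x) ∧
      γR t + γ t + 1 = ρ₀ t := by
    filter_upwards [ae_restrict_mem measurableSet_Icc, hCc, hγR, hγpos, hA1, hρ₀]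
      with t h1 h2 h3 h4 h5 h6
    exact ⟨h1, h2, h3, h4, h5, h6⟩
  obtain ⟨E, hEae, hEm, hE⟩ := hgood.exists_measurable_mem
  have hEae' : ∀ᵐ t ∂volume.restrict (Icc 0 T), t ∈ E := hEae
  set h₁ : ℝ → ℝ → ℝ := fun t x => E.indicator (fun t => h t x) t with hh₁
  set ρ : ℝ → ℝ := E.indicator ρ₀ with hρ
  have hh₁E : ∀ t ∈ E, ∀ x, h₁ t x = h t x := fun t ht x => indicator_of_mem ht _
  have hρE : ∀ t ∈ E, ρ t = γR t + γ t + 1 := fun t ht => by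
    rw [hρ, indicator_of_mem ht, (hE t ht).2.2.2.2.2]
  have hh₁0 : ∀ t ∉ E, ∀ x, h₁ t x = 0 := fun t ht x => indicator_of_notMem ht _
  have hρ0 : ∀ t ∉ E, ρ t = 0 := fun t ht => indicator_of_notMem ht _
  have hh₁c : ∀ t, Continuous (h₁ t) := by
    intro t
    by_cases ht : t ∈ E
    · exact (hE t ht).2.1.congr fun x => (hh₁E t ht x).symm
    · exact continuous_const.congr fun x => (hh₁0 t ht x).symm
  have hh₁m : Measurable (Function.uncurry h₁) := by
    have := measurable_uncurry_of_continuous_of_measurable (u := fun x t => h₁ t x) hh₁c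
      (fun x => (hCm x).indicator hEm)
    exact this.comp measurable_swap
  have hρm : Measurable ρ := hρ₀m.measurable.indicator hEm
  have hρint : Integrable ρ := by
    have h1 : IntegrableOn ρ₀ (Icc 0 T) := hρint₀.congr hρ₀
    exact (integrable_indicator_iff hEm).2 (h1.mono_set fun t ht => (hE t ht).1)
  have hγR0 : ∀ t ∈ E, 0 ≤ γR t := fun t ht =>
    (abs_nonneg _).trans ((hE t ht).2.2.1 0 (by simp; linarith))
  set g := penalized h₁ ρ βe R with hg
  have hgm : Measurable (Function.uncurry g) := by
    have e1 : Measurable fun q : ℝ × ℝ => h₁ q.1 (max (-R - 1) (min q.2 (βe q.1))) :=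
      hh₁m.comp (measurable_fst.prodMk (measurable_const.max
        (measurable_snd.min (hβec.measurable.comp measurable_fst))))
    have e2 : Measurable fun q : ℝ × ℝ => βe q.1 := hβec.measurable.comp measurable_fst
    have e3 : Measurable fun q : ℝ × ℝ => ρ q.1 := hρm.comp measurable_fst
    have e4 : Measurable fun q : ℝ × ℝ => q.2 := measurable_snd
    exact (e1.sub (e3.mul (((e4.sub e2).max measurable_const).min measurable_const))).add
      (e3.mul (((measurable_const.sub e4).max measurable_const).min measurable_const))
  have hgc : ∀ t, Continuous (g t) := by
    intro t
    have := hh₁c t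
    change Continuous fun x => penalized h₁ ρ βe R t x
    unfold penalized
    fun_prop
  have hgE0 : ∀ t ∉ E, ∀ x, g t x = 0 := fun t ht x => by
    simp [hg, penalized, hh₁0 t ht, hρ0 t ht]
  have hβE : ∀ t ∈ E, |βe t| ≤ B := fun t ht => by
    rw [hβeq t (hE t ht).1]; exact hB t (hE t ht).1
  have hh₁ρ : ∀ t ∈ E, ∀ x, |x| ≤ R + 1 → |h₁ t x| ≤ ρ t := fun t ht x hx => by
    rw [hh₁E t ht, hρE t ht]
    linarith [(hE t ht).2.2.1 x hx, (hE t ht).2.2.2.1]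
  have hgΓ : ∀ t x, |g t x| ≤ 3 * ρ t := by
    intro t x
    by_cases ht : t ∈ E
    · exact abs_penalized_le (hβE t ht) hRB (hh₁ρ t ht) x
    · simp [hgE0 t ht, hρ0 t ht]
  have hga : ∀ t, 0 ≤ g t (-R - 1) := by
    intro t
    by_cases ht : t ∈ E
    · have h1 := abs_le.1 (hβE t ht)
      rw [hg, penalized_of_le le_rfl (by linarith), hh₁E t ht, hρE t ht]
      have h2 : -R - (-R - 1) = (1 : ℝ) := by ring
      rw [h2, max_eq_left zero_le_one, min_self, mul_one]
      linarith [(hE t ht).2.2.2.2.1 (-R - 1), hγR0 t ht]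
    · rw [hgE0 t ht]
  have hgb : ∀ t, g t (B + 1) ≤ 0 := by
    intro t
    by_cases ht : t ∈ E
    · have h1 := abs_le.1 (hβE t ht)
      rw [hg, penalized_of_ge (by linarith) (by linarith), min_eq_right (by linarith)]
      have h2 := hh₁ρ t ht (βe t) (by linarith [hβE t ht])
      linarith [(abs_le.1 h2).2]
    · rw [hgE0 t ht]
  have hfp : Continuous fun x => max (f x) 0 := hf.max continuous_const
  have hfm : Continuous fun x => max (-f x) 0 := hf.neg.max continuous_const
  set Fp : ℝ → ℝ := fun x => ∫ s in (0 : ℝ)..x, max (f s) 0 with hFp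
  set Fm : ℝ → ℝ := fun x => ∫ s in (0 : ℝ)..x, max (-f s) 0 with hFm
  have hFpd : ∀ x, HasDerivAt Fp (max (f x) 0) x := fun x =>
    (hfp.integral_hasStrictDerivAt 0 x).hasDerivAt
  have hFmd : ∀ x, HasDerivAt Fm (max (-f x) 0) x := fun x =>
    (hfm.integral_hasStrictDerivAt 0 x).hasDerivAt
  have hFpc : Continuous Fp := continuous_iff_continuousAt.2 fun x => (hFpd x).continuousAt
  have hFmc : Continuous Fm := continuous_iff_continuousAt.2 fun x => (hFmd x).continuousAt
  set F : ℝ → ℝ := fun x => Fp x - Fm x with hF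
  have hFd : ∀ x, HasDerivAt F (f x) x := by
    intro x
    refine ((hFpd x).sub (hFmd x)).congr_deriv ?_
    rcases le_total 0 (f x) with hx | hx
    · rw [max_eq_left hx, max_eq_right (by linarith)]; ring
    · rw [max_eq_right hx, max_eq_left (by linarith)]; ring
  have hFc : Continuous F := hFpc.sub hFmc
  obtain ⟨u, u', c, huc, hu'c, huab, hueq, huT, hφu, hgu0⟩ :=
    exists_periodic_solution_of_bounded hT hφmono hφcont hφsurj hφ0
      (monotone_integral_of_nonneg hfp fun x => le_max_right _ _) hFpc
      (monotone_integral_of_nonneg hfm fun x => le_max_right _ _) hFmc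
      (a := -R - 1) (b := B + 1) (by linarith) hgm hgc (hρint.const_mul 3) hgΓ hga hgb
  have hguint : Integrable fun s => g s (u s) :=
    (hρint.const_mul 3).mono' (hgm.comp (measurable_id.prodMk huc.measurable)).aestronglyMeasurable
      (Eventually.of_forall fun t => hgΓ t _)
  have hφuT : u' 0 = u' T := by
    have h1 := hφu 0
    have h2 := hφu T
    rw [intervalIntegral.integral_same] at h1
    rw [hgu0, ← huT] at h2
    exact hφmono.injective (by linarith)
  have hu : IsC1Periodic T u u' := by
    refine ⟨fun t ht => ?_, hu'c.continuousOn, huT, hφuT⟩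
    have hd : HasDerivAt (fun t => u 0 + ∫ s in (0 : ℝ)..t, u' s) (u' t) t :=
      ((hu'c.integral_hasStrictDerivAt 0 t).hasDerivAt).const_add _
    exact hd.hasDerivWithinAt.congr hueq (hueq t ht)
  have hEvol : ∀ᵐ t ∂volume, t ∈ Icc 0 T → t ∈ E :=
    (ae_restrict_iff' measurableSet_Icc).1 hEae'
  have hβvol : ∀ᵐ t ∂volume, t ∈ Icc 0 T → wβ t + f (β t) * β' t + h t (β t) < 0 :=
    (ae_restrict_iff' measurableSet_Icc).1 hβineq
  have hsubint : ∀ {k : ℝ → ℝ}, IntegrableOn k (Icc 0 T) → ∀ s ∈ Icc 0 T, ∀ t ∈ Icc 0 T,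
      s ≤ t → IntervalIntegrable k volume s t := fun hk s hs t ht hst =>
    (intervalIntegrable_iff_integrableOn_Icc_of_le hst).2 (hk.mono_set (Icc_subset_Icc hs.1 ht.2))
  have huβ : ∀ t ∈ Icc 0 T, u t ≤ β t := by
    have key := nonpos_of_periodic_comparison hT (p := fun t => u t - β t)
      (p' := fun t => u' t - β' t)
      (Φ := fun t => φ (u' t) - φ (β' t) + (F (u t) - F (β t)))
      (fun t ht => (hu.1 t ht).sub (hβ.1 t ht))
      (by simp only [huT, hβ.2.2.1]) (by simp only [huT, hφuT, hβ.2.2.1, hβ.2.2.2])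
      (fun t _ h0 h1 => by
        simp only [sub_eq_zero.1 h0, sub_self, add_zero, sub_nonpos] at h1 ⊢
        exact hφmono.monotone h1)
      (fun t _ h0 h1 => by
        simp only [sub_eq_zero.1 h0, sub_self, add_zero, sub_nonneg] at h1 ⊢
        exact hφmono.monotone h1) ?_
    · exact fun t ht => sub_nonpos.1 (key t ht)
    intro s hs t ht hst hpos
    obtain ⟨hβint, hβF⟩ := hβ.integral_comp_mul_deriv hf hFd hs.1 hst.le ht.2
    have hwint := hsubint hβAC.1 s hs t ht hst.le
    have hgint : IntervalIntegrable (fun r => g r (u r)) volume s t := hguint.intervalIntegrable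
    have hgneg : IntervalIntegrable (fun r => -g r (u r)) volume s t := hgint.neg
    have hposint : 0 < ∫ r in s..t, (-(g r (u r)) - wβ r - f (β r) * β' r) := by
      refine integral_pos_of_ae_pos_on hst ((hgneg.sub hwint).sub hβint) ?_
      filter_upwards [hEvol, hβvol] with r h1 h2 hr
      have hrT : r ∈ Icc 0 T := ⟨hs.1.trans hr.1.le, hr.2.le.trans ht.2⟩
      have hrE := h1 hrT
      have hrp := hpos r hr
      have hrβ := abs_le.1 (hβE r hrE)
      have hβr := hβeq r hrT
      rw [hg, penalized_of_ge (by linarith) (by linarith), hh₁E r hrE, hβr]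
      have h3 : 0 ≤ ρ r * min (u r - β r) 1 :=
        mul_nonneg (by rw [hρE r hrE]; linarith [hγR0 r hrE, (hE r hrE).2.2.2.1])
          (le_min hrp.le zero_le_one)
      linarith [h2 hrT]
    rw [intervalIntegral.integral_sub (hgneg.sub hwint) hβint,
      intervalIntegral.integral_sub hgneg hwint, intervalIntegral.integral_neg, hβF] at hposint
    have e1 := intervalIntegral.integral_add_adjacent_intervals (μ := volume)
      (hguint.intervalIntegrable (a := 0) (b := s)) hgint
    have e2 := intervalIntegral.integral_add_adjacent_intervals
      (hsubint hβAC.1 0 h0T s hs hs.1) hwint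
    have e3 := hφu s
    have e4 := hφu t
    have e5 := hβAC.2 s hs
    have e6 := hβAC.2 t ht
    simp only [hF] at hposint ⊢
    linarith
  have hgE : ∀ t ∈ E, g t (u t) = h t (u t) + ρ t * min (max (-R - u t) 0) 1 := by
    intro t ht
    have htT := (hE t ht).1
    rw [hg, penalized_of_le (huab t htT).1 (by rw [hβeq t htT]; exact huβ t htT), hh₁E t ht]
  have hpen : ∀ t ∈ E, 0 ≤ ρ t * min (max (-R - u t) 0) 1 := fun t ht =>
    mul_nonneg (by rw [hρE t ht]; linarith [hγR0 t ht, (hE t ht).2.2.2.1])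
      (le_min (le_max_right _ _) zero_le_one)
  have hgA : ∀ t ∈ Icc 0 T, |φ (u' t) + F (u t) - c| ≤ A := by
    intro t ht
    have h1 : φ (u' t) + F (u t) - c = -∫ s in (0 : ℝ)..t, g s (u s) := by
      linarith [hφu t]
    have habs : IntervalIntegrable (fun s => |g s (u s)|) volume 0 T :=
      hguint.abs.intervalIntegrable
    rw [h1, abs_neg]
    calc |∫ s in (0 : ℝ)..t, g s (u s)| ≤ ∫ s in (0 : ℝ)..t, |g s (u s)| :=
          intervalIntegral.abs_integral_le_integral_abs ht.1
      _ ≤ ∫ s in (0 : ℝ)..T, |g s (u s)| :=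
          intervalIntegral.integral_mono_interval le_rfl ht.1 ht.2
            (Eventually.of_forall fun _ => abs_nonneg _) habs
      _ ≤ ∫ s in (0 : ℝ)..T, (g s (u s) + 2 * γ s) := by
          refine intervalIntegral.integral_mono_ae_restrict hT.le habs
            (hguint.intervalIntegrable.add (hγii.const_mul 2)) ?_
          filter_upwards [hEae'] with s hs
          have h2 := (hE s hs).2.2.2.2.1 (u s)
          rw [hgE s hs, abs_le]
          constructor <;> linarith [hpen s hs, (hE s hs).2.2.2.1]
      _ = A := by
          rw [intervalIntegral.integral_add hguint.intervalIntegrable (hγii.const_mul 2), hgu0,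
            intervalIntegral.integral_const_mul, zero_add]
  have hosc := oscillation_le hT.le hu hFc hcoer hgA
  have huR : ∀ t ∈ Icc 0 T, -R ≤ u t := by
    intro t₁ ht₁
    by_contra! hlt
    have hV := hVil u u' hu fun t ht => by linarith [hosc t₁ ht₁ t ht]
    have hle : ∫ t in Icc (0 : ℝ) T, h t (u t) ≤ ∫ t in Icc (0 : ℝ) T, g t (u t) := by
      by_cases hi : IntegrableOn (fun t => h t (u t)) (Icc 0 T)
      · refine integral_mono_ae hi hguint.integrableOn ?_
        filter_upwards [hEae'] with t ht
        rw [hgE t ht]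
        linarith [hpen t ht]
      · rw [integral_undef hi] at hV
        exact absurd hV (lt_irrefl _)
    rw [intervalIntegral.integral_of_le hT.le, ← integral_Icc_eq_integral_Ioc] at hgu0
    linarith
  have hgh : ∀ t ∈ E, g t (u t) = h t (u t) := by
    intro t ht
    rw [hgE t ht, max_eq_right (by linarith [huR t (hE t ht).1]), min_eq_left zero_le_one,
      mul_zero, add_zero]
  have hsol : IsSolE T φ f h u := by
    have hfu : Continuous fun t => f (u t) * u' t := (hf.comp huc).mul hu'c
    have hfneg : Continuous fun t => -(f (u t) * u' t) := hfu.neg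
    refine ⟨u', fun t => -(f (u t) * u' t) - g t (u t), hu,
      ⟨hfneg.continuousOn.integrableOn_Icc.sub hguint.integrableOn, fun t ht => ?_⟩, ?_⟩
    · have h1 := (hu.integral_comp_mul_deriv hf hFd le_rfl ht.1 ht.2).2
      rw [intervalIntegral.integral_sub (hfneg.intervalIntegrable 0 t)
        hguint.intervalIntegrable, intervalIntegral.integral_neg, h1]
      have h2 := hφu 0
      rw [intervalIntegral.integral_same] at h2
      simp only [hF]
      linarith [hφu t]
    · filter_upwards [hEae'] with t ht
      rw [hgh t ht]
      ring
  exact ⟨u, hsol, hβstrict u hsol huβ⟩
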